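/- arXiv:1706.03889 — 4 statements merged into one kernel-verified Lean document; each statement's English description precedes it below -/
import Mathlib

section
/- Let m ≥ 2 and let R_m = ℂ[t, t^{-1}, u : u^m = p(t)], where p(t) = Σ_{j=0}^{r+1} a_j t^j with a_{r+1} = 1. Then for every integer i one has the congruence ((m+1)(r+1) + i m)\, t^{r+i} u\, dt ≡ −Σ_{j=0}^{r} ((m+1)j + m i) a_j\, t^{i+j−1} u\, dt modulo dR_m, i.e. this identity holds between the corresponding classes in Ω_{R_m}/dR_m. -/
open scoped BigOperators

noncomputable section

/-- The ring `R_m = ℂ[t,t⁻¹,u : u^m = p(t)]`, realized as `ℂ[t,t⁻¹][X]/(X^m - p)`. -/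
abbrev HypRingM (m : ℕ) (p : LaurentPolynomial ℂ) : Type :=
  AdjoinRoot (Polynomial.X ^ m - Polynomial.C p)

/-- The element `t^i` of `R_m`, for `i : ℤ`. -/
noncomputable def tPM (m : ℕ) (p : LaurentPolynomial ℂ) (i : ℤ) : HypRingM m p :=
  AdjoinRoot.of _ (LaurentPolynomial.T i)

/-- The element `u` of `R_m`. -/
noncomputable def uEM (m : ℕ) (p : LaurentPolynomial ℂ) : HypRingM m p := AdjoinRoot.root _

/-- The module of Kähler differentials `Ω_{R_m}` of `R_m` over `ℂ`. -/
abbrev HypOmegaM (m : ℕ) (p : LaurentPolynomial ℂ) := KaehlerDifferential ℂ (HypRingM m p)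

/-- The subspace `dR_m ⊆ Ω_{R_m}` of exact differentials. -/
noncomputable def dSubM (m : ℕ) (p : LaurentPolynomial ℂ) : Submodule ℂ (HypOmegaM m p) :=
  LinearMap.range (KaehlerDifferential.D ℂ (HypRingM m p)).toLinearMap

/-- The quotient `Ω_{R_m}/dR_m`. -/
abbrev HypCenterM (m : ℕ) (p : LaurentPolynomial ℂ) := HypOmegaM m p ⧸ dSubM m p

/-- The class `\overline{f dg}` in `Ω_{R_m}/dR_m`. -/
noncomputable def clsM (m : ℕ) (p : LaurentPolynomial ℂ) (f g : HypRingM m p) :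
    HypCenterM m p :=
  Submodule.Quotient.mk (f • (KaehlerDifferential.D ℂ (HypRingM m p) g))

section Derivation

variable {k R M : Type*} [CommRing k] [CommRing R] [Algebra k R] [AddCommGroup M] [Module k M]
  [Module R M] (D : Derivation k R M) {T : ℤ → R}

/-- A derivation satisfies `D (t^i) = i t^(i-1) D t` for every integer `i`. -/
lemma Derivation.apply_of_map_add_eq_mul (h0 : T 0 = 1) (hT : ∀ i j, T (i + j) = T i * T j)
    (i : ℤ) : D (T i) = ((i : R) * T (i - 1)) • D (T 1) := by
  have step (i : ℤ) : D (T (i + 1)) = T i • D (T 1) + T 1 • D (T i) := by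
    rw [hT, Derivation.leibniz]
  induction i using Int.induction_on with
  | zero => simp [h0]
  | succ n ih =>
    have h : T n = T 1 * T (n - 1) := by rw [← hT]; congr 1; ring
    rw [step, ih, smul_smul, ← add_smul, add_sub_cancel_right, h]
    congr 1
    push_cast
    ring
  | pred n ih =>
    have h := step (-(n : ℤ) - 1)
    rw [sub_add_cancel, ih] at h
    have h' := congrArg (fun x => T (-1) • x) h
    have h1 : T (-1) * T 1 = 1 := by rw [← hT, ← h0]; rfl
    have h2 : T (-(n : ℤ) - 1 - 1) = T (-1) * T (-(n : ℤ) - 1) := by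
      rw [← hT]; congr 1; ring
    simp only [smul_add, smul_smul, h1, one_smul] at h'
    rw [← sub_eq_iff_eq_add', ← sub_smul] at h'
    rw [← h', h2]
    congr 1
    push_cast
    ring

/-- If `u^m = ∑ a_j t^j`, then `m D (t^i u^(m+1))` expands in terms of the `t^k u D t`. -/
lemma Derivation.smul_apply_mul_pow_succ [IsScalarTower k R M] (h0 : T 0 = 1)
    (hT : ∀ i j, T (i + j) = T i * T j) {u : R} {m : ℕ} (hm : m ≠ 0) (s : Finset ℕ) (a : ℕ → k)
    (hu : u ^ m = ∑ j ∈ s, a j • T j) (i : ℤ) :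
    (m : k) • D (T i * u ^ (m + 1)) =
      ∑ j ∈ s, ((((m : ℤ) + 1) * (j : ℤ) + (m : ℤ) * i : ℤ) : k) • (a j •
        ((T (i + (j : ℤ) - 1) * u) • D (T 1))) := by
  have hDu : u • D (u ^ m) = (m : R) • u ^ m • D u := by
    rw [Derivation.leibniz_pow, smul_comm, ← Nat.cast_smul_eq_nsmul R, smul_smul u,
      ← pow_succ', Nat.sub_add_cancel (Nat.one_le_iff_ne_zero.mpr hm)]
  have key : (m : k) • D (T i * u ^ (m + 1)) =
      (((m : R) + 1) * T i * u) • D (u ^ m) + ((m : R) * u * u ^ m) • D (T i) := by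
    rw [Nat.cast_smul_eq_nsmul, ← Nat.cast_smul_eq_nsmul R, pow_succ, Derivation.leibniz,
      Derivation.leibniz]
    linear_combination (norm := module) (-T i) • hDu
  rw [key, hu, map_sum, Finset.smul_sum, Finset.mul_sum, Finset.sum_smul,
    ← Finset.sum_add_distrib]
  refine Finset.sum_congr rfl fun j _ => ?_
  have e1 : T (i + j - 1) = T i * T (j - 1) := by rw [← hT]; congr 1; ring
  have e2 : T (i + j - 1) = T j * T (i - 1) := by rw [← hT]; congr 1; ring
  rw [Derivation.map_smul, D.apply_of_map_add_eq_mul h0 hT j,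
    D.apply_of_map_add_eq_mul h0 hT i, Int.cast_smul_eq_zsmul k, ← Int.cast_smul_eq_zsmul R]
  simp only [← algebraMap_smul R (a j), smul_smul, ← add_smul, smul_eq_mul]
  congr 1
  push_cast
  linear_combination (-algebraMap k R (a j) * u * (m + 1) * j) * e1 -
    algebraMap k R (a j) * u * m * i * e2

end Derivation

lemma tPM_add (m : ℕ) (p : LaurentPolynomial ℂ) (i j : ℤ) :
    tPM m p (i + j) = tPM m p i * tPM m p j := by
  simp only [tPM, LaurentPolynomial.T_add, map_mul]

lemma tPM_zero (m : ℕ) (p : LaurentPolynomial ℂ) : tPM m p 0 = 1 := by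
  simp only [tPM, LaurentPolynomial.T_zero, map_one]

lemma uEM_pow (m : ℕ) (p : LaurentPolynomial ℂ) :
    uEM m p ^ m = AdjoinRoot.of (Polynomial.X ^ m - Polynomial.C p) p := by
  have h := AdjoinRoot.eval₂_root (Polynomial.X ^ m - Polynomial.C p)
  simp only [Polynomial.eval₂_sub, Polynomial.eval₂_pow, Polynomial.eval₂_X,
    Polynomial.eval₂_C] at h
  exact sub_eq_zero.mp h

lemma of_C_mul_T (m : ℕ) (p : LaurentPolynomial ℂ) (c : ℂ) (i : ℤ) :
    AdjoinRoot.of (Polynomial.X ^ m - Polynomial.C p)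
      (LaurentPolynomial.C c * LaurentPolynomial.T i) = c • tPM m p i := by
  rw [← LaurentPolynomial.smul_eq_C_mul, tPM, AdjoinRoot.smul_of]

/-- The polynomial relation between `u` and `t`, with `p` expanded. -/
lemma uEM_pow_eq_sum (m : ℕ) (s : Finset ℕ) (a : ℕ → ℂ) (p : LaurentPolynomial ℂ)
    (hpa : p = ∑ j ∈ s, LaurentPolynomial.C (a j) * LaurentPolynomial.T (j : ℤ)) :
    uEM m p ^ m = ∑ j ∈ s, a j • tPM m p j := by
  rw [uEM_pow]
  conv_lhs => rw [congrArg (AdjoinRoot.of (Polynomial.X ^ m - Polynomial.C p)) hpa]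
  rw [map_sum]
  exact Finset.sum_congr rfl fun j _ => of_C_mul_T m p (a j) j

/-- The exactness of `m d(t^i u^(m+1))` as a linear relation between classes. -/
lemma sum_smul_clsM_eq_zero (m : ℕ) (hm : m ≠ 0) (s : Finset ℕ) (a : ℕ → ℂ)
    (p : LaurentPolynomial ℂ)
    (hpa : p = ∑ j ∈ s, LaurentPolynomial.C (a j) * LaurentPolynomial.T (j : ℤ)) (i : ℤ) :
    ∑ j ∈ s, ((((m : ℤ) + 1) * (j : ℤ) + (m : ℤ) * i : ℤ) : ℂ) • (a j •
      clsM m p (tPM m p (i + (j : ℤ) - 1) * uEM m p) (tPM m p 1)) = 0 := by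
  have h := (KaehlerDifferential.D ℂ (HypRingM m p)).smul_apply_mul_pow_succ (tPM_zero m p)
    (tPM_add m p) hm s a (uEM_pow_eq_sum m s a p hpa) i
  have hmem := (dSubM m p).smul_mem (m : ℂ) (LinearMap.mem_range_self
    (KaehlerDifferential.D ℂ (HypRingM m p)).toLinearMap (tPM m p i * uEM m p ^ (m + 1)))
  have h0 := (congrArg (dSubM m p).mkQ h).symm.trans
    ((Submodule.Quotient.mk_eq_zero _).mpr hmem)
  rw [map_sum] at h0
  exact h0

/-- For `R_m = ℂ[t,t⁻¹,u : u^m = p(t)]` with `p(t) = Σ_{j=0}^{r+1} a_j t^j`, `a_{r+1}=1`, one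
has the congruence
`((m+1)(r+1) + i m) t^{r+i} u dt ≡ −Σ_{j=0}^{r} ((m+1)j + m i) a_j t^{i+j−1} u dt (mod dR_m)`
for every integer `i`. -/
theorem recursion_mod_dR (r : ℕ) (hr : 1 ≤ r) (m : ℕ) (hm : 2 ≤ m)
    (a : ℕ → ℂ) (ha : a (r + 1) = 1)
    (p : LaurentPolynomial ℂ)
    (hpa : p = ∑ j ∈ Finset.range (r + 2),
      LaurentPolynomial.C (a j) * LaurentPolynomial.T (j : ℤ)) :
    ∀ i : ℤ,
      ((((m : ℤ) + 1) * ((r : ℤ) + 1) + i * m : ℤ) : ℂ) •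
          clsM m p (tPM m p ((r : ℤ) + i) * uEM m p) (tPM m p 1)
        = -∑ j ∈ Finset.range (r + 1),
            ((((m : ℤ) + 1) * (j : ℤ) + (m : ℤ) * i : ℤ) : ℂ) • (a j •
              clsM m p (tPM m p (i + (j : ℤ) - 1) * uEM m p) (tPM m p 1)) := by
  intro i
  have h := sum_smul_clsM_eq_zero m (by omega) (Finset.range (r + 2)) a p hpa i
  rw [Finset.sum_range_succ, ha, one_smul] at h
  rw [eq_neg_iff_add_eq_zero, add_comm]
  have e1 : i + ((r + 1 : ℕ) : ℤ) - 1 = r + i := by push_cast; ring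
  have e2 : ((m : ℤ) + 1) * ((r + 1 : ℕ) : ℤ) + m * i = (m + 1) * (r + 1) + i * m := by
    push_cast; ring
  rw [e1, e2] at h
  exact h

end
end

section
/- For every integer ι ≥ −r one has \overline{t^{ι} u\, dt} = Σ_{k=1}^{r} P_{ι,−k}\, ω_k in Ω_R/dR. -/
open scoped BigOperators

noncomputable section

/-- The hyperelliptic ring `R = ℂ[t,t⁻¹,u : u² = p(t)]`, realized as
`ℂ[t,t⁻¹][X]/(X² - p)`. -/
abbrev HypRing (p : LaurentPolynomial ℂ) : Type :=
  AdjoinRoot (Polynomial.X ^ 2 - Polynomial.C p)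

/-- The element `t^i` of `R`, for `i : ℤ`. -/
noncomputable def tP (p : LaurentPolynomial ℂ) (i : ℤ) : HypRing p :=
  AdjoinRoot.of _ (LaurentPolynomial.T i)

/-- The element `u` of `R`. -/
noncomputable def uE (p : LaurentPolynomial ℂ) : HypRing p := AdjoinRoot.root _

/-- The module of Kähler differentials `Ω_R` of `R` over `ℂ`. -/
abbrev HypOmega (p : LaurentPolynomial ℂ) := KaehlerDifferential ℂ (HypRing p)

/-- The subspace `dR ⊆ Ω_R` of exact differentials. -/
noncomputable def dSub (p : LaurentPolynomial ℂ) : Submodule ℂ (HypOmega p) :=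
  LinearMap.range (KaehlerDifferential.D ℂ (HypRing p)).toLinearMap

/-- The quotient `Ω_R/dR`. -/
abbrev HypCenter (p : LaurentPolynomial ℂ) := HypOmega p ⧸ dSub p

/-- The class `\overline{f dg}` of `f dg` in `Ω_R/dR`. -/
noncomputable def cls (p : LaurentPolynomial ℂ) (f g : HypRing p) : HypCenter p :=
  Submodule.Quotient.mk (f • (KaehlerDifferential.D ℂ (HypRing p) g))

/-- `ω₀ = \overline{t⁻¹ dt}` and `ω_k = \overline{t^{-k} u dt}` for `k ≥ 1`. -/
noncomputable def om (p : LaurentPolynomial ℂ) (k : ℕ) : HypCenter p :=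
  if k = 0 then cls p (tP p (-1)) (tP p 1)
  else cls p (tP p (-(k : ℤ)) * uE p) (tP p 1)

theorem tP_add (p : LaurentPolynomial ℂ) (m n : ℤ) : tP p (m + n) = tP p m * tP p n := by
  rw [tP, LaurentPolynomial.T_add, map_mul, tP, tP]

theorem tP_zero (p : LaurentPolynomial ℂ) : tP p 0 = 1 := by
  simp [tP]

theorem D_tP (p : LaurentPolynomial ℂ) (m : ℤ) :
    KaehlerDifferential.D ℂ (HypRing p) (tP p m)
      = (m : ℂ) • tP p (m - 1) • KaehlerDifferential.D ℂ (HypRing p) (tP p 1) := by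
  have step (n : ℤ) : KaehlerDifferential.D ℂ (HypRing p) (tP p (n + 1))
      = tP p n • KaehlerDifferential.D ℂ (HypRing p) (tP p 1)
        + tP p 1 • KaehlerDifferential.D ℂ (HypRing p) (tP p n) := by
    rw [tP_add, Derivation.leibniz]
  induction m using Int.induction_on with
  | zero => simp [tP_zero]
  | succ n ih =>
    rw [step, ih, smul_comm (tP p 1), smul_smul (tP p 1), ← tP_add, add_sub_cancel,
      add_sub_cancel_right]
    push_cast
    rw [add_smul, one_smul, add_comm]
  | pred n ih =>
    have h := step (-(n : ℤ) - 1)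
    rw [sub_add_cancel, ih] at h
    have h' := congrArg (fun x => tP p (-1) • x) h
    simp only [smul_add, smul_smul (tP p (-1)), ← tP_add, smul_comm (tP p (-1)) (_ : ℂ)] at h'
    rw [neg_add_cancel, tP_zero, one_smul, neg_add_eq_sub] at h'
    rw [← sub_eq_iff_eq_add'.mpr h']
    push_cast
    rw [sub_smul (-(n : ℂ)), one_smul]

theorem uE_sq (p : LaurentPolynomial ℂ) : uE p * uE p = AdjoinRoot.of _ p := by
  rw [← sub_eq_zero, ← sq, uE, ← AdjoinRoot.mk_X, ← AdjoinRoot.mk_C, ← map_pow, ← map_sub,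
    AdjoinRoot.mk_self]

theorem of_sum_C_mul_T (p : LaurentPolynomial ℂ) (s : Finset ℕ) (a : ℕ → ℂ) :
    AdjoinRoot.of (Polynomial.X ^ 2 - Polynomial.C p)
        (∑ i ∈ s, LaurentPolynomial.C (a i) * LaurentPolynomial.T (i : ℤ))
      = ∑ i ∈ s, a i • tP p i := by
  rw [map_sum]
  refine Finset.sum_congr rfl fun i _ => ?_
  rw [map_mul, ← tP, Algebra.smul_def, AdjoinRoot.algebraMap_eq']
  congr 1

/-- The relation in `Ω_R/dR` expressing that `2 d(t^m u³)` is exact. -/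
theorem sum_cls_eq_zero (p : LaurentPolynomial ℂ) (s : Finset ℕ) (a : ℕ → ℂ)
    (hpa : p = ∑ i ∈ s, LaurentPolynomial.C (a i) * LaurentPolynomial.T (i : ℤ)) (m : ℤ) :
    ∑ i ∈ s, ((3 * (i : ℤ) + 2 * m : ℤ) : ℂ) • a i •
      cls p (tP p (m + i - 1) * uE p) (tP p 1) = 0 := by
  have hu : uE p * uE p = ∑ i ∈ s, a i • tP p i := by
    rw [uE_sq, ← of_sum_C_mul_T, ← hpa]
  set D := KaehlerDifferential.D ℂ (HypRing p)
  have hdu : (2 : ℂ) • uE p • D (uE p)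
      = ∑ i ∈ s, a i • (i : ℂ) • tP p (i - 1) • D (tP p 1) := by
    have h := congrArg D hu
    rw [Derivation.leibniz, ← two_smul ℂ, map_sum] at h
    rw [h]
    refine Finset.sum_congr rfl fun i _ => ?_
    rw [Derivation.map_smul, D_tP]
    simp [D]
  have hsum : tP p m * (uE p * uE p) = ∑ i ∈ s, a i • tP p (m + i) := by
    rw [hu, Finset.mul_sum]
    exact Finset.sum_congr rfl fun i _ => by rw [mul_smul_comm, tP_add]
  have hdt : D (tP p m * (uE p * uE p))
      = ∑ i ∈ s, a i • ((m + i : ℤ) : ℂ) • tP p (m + i - 1) • D (tP p 1) := by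
    rw [hsum, map_sum]
    exact Finset.sum_congr rfl fun i _ => by rw [Derivation.map_smul, D_tP]
  have key : (2 : ℂ) • D (tP p m * (uE p * uE p) * uE p)
      = ∑ i ∈ s, ((3 * (i : ℤ) + 2 * m : ℤ) : ℂ) • a i •
        (tP p (m + i - 1) * uE p) • D (tP p 1) := by
    rw [Derivation.leibniz, smul_add, hdt,
      show (tP p m * (uE p * uE p)) • D (uE p) = (tP p m * uE p) • uE p • D (uE p) by
        rw [smul_smul, mul_assoc],
      smul_comm (2 : ℂ) (tP p m * uE p), hdu, Finset.smul_sum, Finset.smul_sum,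
      Finset.smul_sum, ← Finset.sum_add_distrib]
    refine Finset.sum_congr rfl fun i _ => ?_
    have e : tP p (m + i - 1) * uE p = tP p m * uE p * tP p (i - 1) := by
      rw [add_sub_assoc, tP_add]; ring
    rw [smul_comm (uE p) (a i), smul_comm (uE p) (_ : ℂ), smul_smul (uE p),
      mul_comm (uE p), smul_comm (tP p m * uE p) (a i), smul_comm (tP p m * uE p) (_ : ℂ),
      smul_smul (tP p m * uE p), ← e]
    simp only [smul_smul (M := ℂ), ← add_smul]
    congr 1
    push_cast
    ring
  have hmem : ∑ i ∈ s, ((3 * (i : ℤ) + 2 * m : ℤ) : ℂ) • a i •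
      (tP p (m + i - 1) * uE p) • D (tP p 1) ∈ dSub p := by
    rw [← key]
    exact Submodule.smul_mem _ _ ⟨_, rfl⟩
  rw [← Submodule.ker_mkQ (dSub p), LinearMap.mem_ker, map_sum] at hmem
  simp only [map_smul] at hmem
  exact hmem

theorem leading_coeff_eq_one (r : ℕ) (α : Fin r → ℂ) (a : ℕ → ℂ)
    (h : LaurentPolynomial.T 1 *
        ∏ i : Fin r, (LaurentPolynomial.T 1 - LaurentPolynomial.C (α i))
      = ∑ i ∈ Finset.Icc 1 (r + 1),
        LaurentPolynomial.C (a i) * LaurentPolynomial.T (i : ℤ)) :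
    a (r + 1) = 1 := by
  have hq : (Polynomial.X * ∏ i : Fin r, (Polynomial.X - Polynomial.C (α i)))
      = ∑ i ∈ Finset.Icc 1 (r + 1), Polynomial.C (a i) * Polynomial.X ^ i := by
    apply Polynomial.toLaurent_injective
    simpa [map_prod] using h
  have hm : (∏ i : Fin r, (Polynomial.X - Polynomial.C (α i))).Monic :=
    Polynomial.monic_prod_of_monic _ _ fun i _ => Polynomial.monic_X_sub_C _
  have hd : (∏ i : Fin r, (Polynomial.X - Polynomial.C (α i))).natDegree = r := by
    rw [Polynomial.natDegree_prod_of_monic _ _ fun i _ => Polynomial.monic_X_sub_C _]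
    simp
  have hc := congrArg (Polynomial.coeff · (r + 1)) hq
  simp only [Polynomial.coeff_X_mul, Polynomial.finsetSum_coeff,
    Polynomial.coeff_C_mul_X_pow] at hc
  rw [Finset.sum_ite_eq, if_pos (by simp)] at hc
  rw [← hc]
  simpa [Polynomial.Monic, Polynomial.leadingCoeff, hd] using hm

/-- For every integer `ι ≥ −r` one has `\overline{t^ι u dt} = Σ_{k=1}^{r} P_{ι,−k} ω_k`
in `Ω_R/dR`. -/
theorem tpow_u_dt_eq_P_sum (r : ℕ) (hr : 1 ≤ r)
    (α : Fin r → ℂ) (hα0 : ∀ i, α i ≠ 0) (hαinj : Function.Injective α)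
    (a : ℕ → ℂ) (p : LaurentPolynomial ℂ)
    (hp : p = LaurentPolynomial.T 1 *
      ∏ i : Fin r, (LaurentPolynomial.T 1 - LaurentPolynomial.C (α i)))
    (hpa : p = ∑ i ∈ Finset.Icc 1 (r + 1),
      LaurentPolynomial.C (a i) * LaurentPolynomial.T (i : ℤ))
    (P : ℤ → ℤ → ℂ)
    (hPinit : ∀ l i : ℤ, -(r : ℤ) ≤ l → l ≤ -1 → -(r : ℤ) ≤ i → i ≤ -1 →
      P l i = if l = i then 1 else 0)
    (hPrec : ∀ k : ℤ, 0 ≤ k → ∀ i : ℤ,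
      ((2 * k + (r : ℤ) + 3 : ℤ) : ℂ) * P k i
        = -∑ j ∈ Finset.Icc 1 r,
            ((3 * (j : ℤ) + 2 * k - 2 * (r : ℤ) : ℤ) : ℂ) * a j * P (k - r + j - 1) i) :
    ∀ ι : ℤ, -(r : ℤ) ≤ ι →
      cls p (tP p ι * uE p) (tP p 1)
        = ∑ k ∈ Finset.Icc 1 r, P ι (-(k : ℤ)) • om p k := by
  have ha : a (r + 1) = 1 := leading_coeff_eq_one r α a (hp.symm.trans hpa)
  intro ι hι
  induction hn : (ι + r).toNat using Nat.strong_induction_on generalizing ι with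
  | _ n ih =>
  rcases lt_or_ge ι 0 with hneg | hpos
  · have hmem : (-ι).toNat ∈ Finset.Icc 1 r := by rw [Finset.mem_Icc]; omega
    have hcast : ((-ι).toNat : ℤ) = -ι := by omega
    rw [Finset.sum_eq_single_of_mem _ hmem, hPinit _ _ hι (by omega) (by omega) (by omega),
      if_pos (by omega), one_smul, om, if_neg (by omega), hcast, neg_neg]
    intro k hk hne
    rw [Finset.mem_Icc] at hk
    rw [hPinit _ _ hι (by omega) (by omega) (by omega), if_neg (by omega), zero_smul]
  · have hrel := sum_cls_eq_zero p _ a hpa (ι - r)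
    rw [Finset.sum_Icc_succ_top (by omega), ha, one_smul] at hrel
    have hc : ((2 * ι + (r : ℤ) + 3 : ℤ) : ℂ) ≠ 0 := Int.cast_ne_zero.mpr (by omega)
    have e₁ : (ι - r + (r + 1 : ℕ) - 1 : ℤ) = ι := by push_cast; ring
    have e₂ : (3 * ((r + 1 : ℕ) : ℤ) + 2 * (ι - r) : ℤ) = 2 * ι + r + 3 := by push_cast; ring
    rw [e₁, e₂, add_comm, add_eq_zero_iff_eq_neg] at hrel
    apply smul_right_injective _ hc
    simp only
    rw [hrel, Finset.smul_sum]
    simp only [smul_smul, hPrec ι hpos, neg_smul, Finset.sum_smul, Finset.sum_neg_distrib]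
    rw [Finset.sum_comm]
    congr 1
    refine Finset.sum_congr rfl fun j hj => ?_
    rw [Finset.mem_Icc] at hj
    rw [ih (ι - r + j - 1 + r).toNat (by omega) (ι - r + j - 1) (by omega) rfl, Finset.smul_sum]
    refine Finset.sum_congr rfl fun k _ => ?_
    rw [smul_smul]
    congr 3
    push_cast
    ring

end
end

section
/- Let c ∈ ℂ^× and ε ∈ {+1, −1}, and suppose the assignment ψ(t) = c² t^{-1}, ψ(u) = ε^{1/2}-twisted as follows — ψ(u) = c^{n+1} t^{-n-1} u when a₁ = c^{2n}, respectively ψ(u) = ı c^{n+1} t^{-n-1} u when a₁ = −c^{2n} — defines a ℂ-algebra automorphism of R (equivalently, ψ(u)² = ψ(p(t)) in R). Then the coefficients of p satisfy a_j = c^{2n−2j+2} a_{2n+2−j} for all j = 1, …, 2n+1 in the first case, respectively a_j = −c^{2n−2j+2} a_{2n+2−j} for all j = 1, …, 2n+1 in the second case. -/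
open scoped BigOperators

noncomputable section

open LaurentPolynomial in
theorem coefficient_relation_of_algHom (n : ℕ) (a : ℕ → ℂ) (p : LaurentPolynomial ℂ)
    (hpa : p = ∑ i ∈ Finset.Icc 1 (2 * n + 1), C (a i) * T (i : ℤ)) (c e : ℂ)
    (ψ : HypRing p →ₐ[ℂ] HypRing p) (ht : ψ (tP p 1) = c ^ 2 • tP p (-1))
    (hu : ψ (uE p) = e • (tP p (-(n : ℤ) - 1) * uE p)) (j : ℕ) (hj : 1 ≤ j)
    (hj' : j ≤ 2 * n + 1) : a j * c ^ (2 * j) = e ^ 2 * a (2 * n + 2 - j) := by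
  set f : Polynomial (LaurentPolynomial ℂ) := Polynomial.X ^ 2 - Polynomial.C p with hf
  let φ : LaurentPolynomial ℂ →ₐ[ℂ] HypRing p := AdjoinRoot.ofAlgHom ℂ f
  have htP : ∀ i, tP p i = φ (T i) := fun _ => rfl
  have hφ : Function.Injective φ := by
    have hd : f.degree ≠ 0 := by
      rw [hf, Polynomial.degree_X_pow_sub_C (by norm_num)]
      norm_num
    exact AdjoinRoot.of.injective_of_degree_ne_zero hd
  have hu2 : uE p ^ 2 = φ p := by
    have h := AdjoinRoot.eval₂_root f
    rw [hf, Polynomial.eval₂_sub, Polynomial.eval₂_pow, Polynomial.eval₂_X,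
      Polynomial.eval₂_C, sub_eq_zero] at h
    exact h
  have hC : ∀ (z : ℂ) (q : LaurentPolynomial ℂ), C z * q = z • q := fun z q =>
    (LaurentPolynomial.smul_eq_C_mul z q).symm
  have hψp : ψ (φ p) = φ (∑ i ∈ Finset.Icc 1 (2 * n + 1),
      (a i * c ^ (2 * i)) • T (-(i : ℤ))) := by
    rw [congrArg φ hpa]
    simp only [map_sum, hC, map_smul]
    refine Finset.sum_congr rfl fun i _ => ?_
    have hT : (T (i : ℤ) : LaurentPolynomial ℂ) = T 1 ^ i := by simp [T_pow]
    have hT' : (T (-(i : ℤ)) : LaurentPolynomial ℂ) = T (-1) ^ i := by simp [T_pow]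
    rw [hT, hT', map_pow, map_pow, map_pow, ← htP, ht, ← htP, smul_pow, smul_smul, pow_mul]
  have hψu : ψ (uE p) ^ 2 = φ (∑ i ∈ Finset.Icc 1 (2 * n + 1),
      (e ^ 2 * a i) • T ((i : ℤ) - (2 * n + 2))) := by
    rw [hu, smul_pow, mul_pow, hu2, htP, ← map_pow, ← map_mul, ← map_smul]
    congr 1
    rw [congrArg (T (-(n : ℤ) - 1) ^ 2 * ·) hpa]
    rw [Finset.mul_sum, Finset.smul_sum]
    refine Finset.sum_congr rfl fun i _ => ?_
    rw [hC, mul_smul_comm, smul_smul, T_pow, ← T_add]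
    congr 2
    push_cast
    ring
  have key := hφ (hψp.symm.trans ((congrArg ψ hu2).symm.trans ((map_pow ψ _ _).trans hψu)))
  have hcoeff := congrArg (fun q : LaurentPolynomial ℂ => q.coeff (-(j : ℤ))) key
  simp only [AddMonoidAlgebra.coeff_sum, Finset.sum_apply', AddMonoidAlgebra.coeff_smul,
    Finsupp.smul_apply, T_apply, smul_eq_mul, mul_ite, mul_one, mul_zero] at hcoeff
  rw [Finset.sum_eq_single_of_mem j (by simp; omega) fun i _ hi => if_neg (by omega),
    Finset.sum_eq_single_of_mem (2 * n + 2 - j) (by simp; omega) fun i hi hij =>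
      if_neg (by simp at hi; omega), if_pos rfl, if_pos (by omega)] at hcoeff
  exact hcoeff

theorem zpow_index_eq (n j : ℕ) {c : ℂ} (hc : c ≠ 0) :
    c ^ (2 * (n : ℤ) - 2 * (j : ℤ) + 2) = c ^ (2 * n + 2) / c ^ (2 * j) := by
  rw [← zpow_natCast c (2 * n + 2), ← zpow_natCast c (2 * j), ← zpow_sub₀ hc]
  congr 1
  push_cast
  ring

/-- If the assignment `ψ(t) = c²t⁻¹`, `ψ(u) = c^{n+1}t^{-n-1}u` (when `a₁ = c^{2n}`),
resp. `ψ(u) = ıc^{n+1}t^{-n-1}u` (when `a₁ = −c^{2n}`), defines a `ℂ`-algebra automorphism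
of `R`, then `a_j = c^{2n−2j+2} a_{2n+2−j}` resp. `a_j = −c^{2n−2j+2} a_{2n+2−j}` for
`j = 1, …, 2n+1`. -/
theorem coefficient_symmetry (n : ℕ) (hn : 1 ≤ n)
    (α : Fin (2 * n) → ℂ) (hα0 : ∀ i, α i ≠ 0) (hαinj : Function.Injective α)
    (a : ℕ → ℂ) (p : LaurentPolynomial ℂ)
    (hp : p = LaurentPolynomial.T 1 *
      ∏ i : Fin (2 * n), (LaurentPolynomial.T 1 - LaurentPolynomial.C (α i)))
    (hpa : p = ∑ i ∈ Finset.Icc 1 (2 * n + 1),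
      LaurentPolynomial.C (a i) * LaurentPolynomial.T (i : ℤ))
    (c : ℂ) (hc : c ≠ 0) :
    (a 1 = c ^ (2 * n) →
      (∃ ψ : HypRing p ≃ₐ[ℂ] HypRing p,
        ψ (tP p 1) = c ^ 2 • tP p (-1) ∧
        ψ (uE p) = c ^ (n + 1) • (tP p (-(n : ℤ) - 1) * uE p)) →
      ∀ j : ℕ, 1 ≤ j → j ≤ 2 * n + 1 →
        a j = c ^ (2 * (n : ℤ) - 2 * (j : ℤ) + 2) * a (2 * n + 2 - j)) ∧
    (a 1 = -c ^ (2 * n) →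
      (∃ ψ : HypRing p ≃ₐ[ℂ] HypRing p,
        ψ (tP p 1) = c ^ 2 • tP p (-1) ∧
        ψ (uE p) = (Complex.I * c ^ (n + 1)) • (tP p (-(n : ℤ) - 1) * uE p)) →
      ∀ j : ℕ, 1 ≤ j → j ≤ 2 * n + 1 →
        a j = -(c ^ (2 * (n : ℤ) - 2 * (j : ℤ) + 2) * a (2 * n + 2 - j))) := by
  constructor
  · rintro - ⟨ψ, ht, hu⟩ j hj hj'
    have h := coefficient_relation_of_algHom n a p hpa c _ ψ.toAlgHom ht hu j hj hj'
    rw [zpow_index_eq n j hc, div_mul_eq_mul_div, eq_div_iff (pow_ne_zero _ hc), h]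
    ring
  · rintro - ⟨ψ, ht, hu⟩ j hj hj'
    have h := coefficient_relation_of_algHom n a p hpa c _ ψ.toAlgHom ht hu j hj hj'
    rw [zpow_index_eq n j hc, div_mul_eq_mul_div, ← neg_div, eq_div_iff (pow_ne_zero _ hc), h,
      mul_pow, Complex.I_sq]
    ring

end
end

section
/- Suppose k | 2n and a_j = 0 whenever j ≢ 1 (mod k). Then for all l ≥ −2n and 1 ≤ i ≤ 2n, P_{l,−i} = 0 unless l ≡ −i (mod k). In particular, if in addition k is even and k | n, then P_{i−n−3,−i} = 0 for all n+3 ≤ i ≤ 2n. -/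
open scoped BigOperators

/-- Suppose `k ∣ 2n` and `a_j = 0` whenever `j ≢ 1 (mod k)`.  Then `P_{l,−i} = 0` unless
`l ≡ −i (mod k)`; in particular, if moreover `k` is even and `k ∣ n`, then
`P_{i−n−3,−i} = 0` for all `n+3 ≤ i ≤ 2n`. -/
theorem P_vanishing (n k : ℕ) (hn : 1 ≤ n) (hk : 1 ≤ k) (hkdvd : k ∣ 2 * n)
    (a : ℕ → ℂ) (ha1 : a 1 ≠ 0) (hatop : a (2 * n + 1) = 1)
    (ha0 : ∀ j : ℕ, 1 ≤ j → j ≤ 2 * n + 1 → j % k ≠ 1 % k → a j = 0)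
    (P : ℤ → ℤ → ℂ)
    (hPinit : ∀ l i : ℤ, -(2 * n : ℤ) ≤ l → l ≤ -1 → -(2 * n : ℤ) ≤ i → i ≤ -1 →
      P l i = if l = i then 1 else 0)
    (hPrec : ∀ m : ℤ, 0 ≤ m → ∀ i : ℤ,
      ((2 * m + 2 * (n : ℤ) + 3 : ℤ) : ℂ) * P m i
        = -∑ j ∈ Finset.Icc 1 (2 * n),
            ((3 * (j : ℤ) + 2 * m - 4 * (n : ℤ) : ℤ) : ℂ) * a j * P (m - 2 * n + j - 1) i) :
    (∀ l : ℤ, -(2 * n : ℤ) ≤ l → ∀ i : ℕ, 1 ≤ i → i ≤ 2 * n →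
      ¬ Int.ModEq (k : ℤ) l (-(i : ℤ)) → P l (-(i : ℤ)) = 0) ∧
    (Even k → k ∣ n → ∀ i : ℕ, n + 3 ≤ i → i ≤ 2 * n →
      P ((i : ℤ) - n - 3) (-(i : ℤ)) = 0) := by
  have vanish : ∀ N : ℕ, ∀ l : ℤ, -(2 * n : ℤ) ≤ l → l + 2 * n < N → ∀ i : ℕ, 1 ≤ i → i ≤ 2 * n →
      ¬ Int.ModEq (k : ℤ) l (-(i : ℤ)) → P l (-(i : ℤ)) = 0 := by
    intro N
    induction N with
    | zero => intro l hl hlN; push_cast at hlN; omega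
    | succ N ih =>
      intro l hl hlN i hi1 hi2 hmod
      push_cast at hlN
      rcases lt_or_ge l 0 with hneg | hpos
      · rw [hPinit l (-(i : ℤ)) hl (by omega) (by omega) (by omega), if_neg]
        rintro rfl
        exact hmod rfl
      · have hrec := hPrec l hpos (-(i : ℤ))
        rw [Finset.sum_eq_zero, neg_zero] at hrec
        · refine (mul_eq_zero.mp hrec).resolve_left ?_
          exact_mod_cast (by omega : (2 * l + 2 * (n : ℤ) + 3) ≠ 0)
        · intro j hj
          obtain ⟨hj1, hj2⟩ := Finset.mem_Icc.mp hj
          by_cases hjk : j % k = 1 % k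
          · rw [ih (l - 2 * n + j - 1) (by omega) (by omega) i hi1 hi2, mul_zero]
            intro h
            apply hmod
            have hj' : (j : ℤ) ≡ 1 [ZMOD k] := by
              exact_mod_cast (Int.natCast_modEq_iff.mpr (show j ≡ 1 [MOD k] from hjk))
            have hdiv : (k : ℤ) ∣ 2 * n := by exact_mod_cast hkdvd
            refine Int.ModEq.trans ?_ h
            rw [Int.modEq_iff_dvd]
            rw [show l - 2 * n + j - 1 - l = (j : ℤ) - 1 - 2 * n by ring]
            exact dvd_sub hj'.symm.dvd hdiv
          · rw [ha0 j hj1 (by omega) hjk, mul_zero, zero_mul]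
  have hvan : ∀ l : ℤ, -(2 * n : ℤ) ≤ l → ∀ i : ℕ, 1 ≤ i → i ≤ 2 * n →
      ¬ Int.ModEq (k : ℤ) l (-(i : ℤ)) → P l (-(i : ℤ)) = 0 := fun l hl =>
    vanish (l + 2 * n + 1).toNat l hl (by omega)
  refine ⟨hvan, fun hke hkn i hi1 hi2 => hvan _ (by omega) i (by omega) hi2 fun h => ?_⟩
  have h2k : (2 : ℤ) ∣ k := by exact_mod_cast hke.two_dvd
  have h2n : (2 : ℤ) ∣ n := h2k.trans (by exact_mod_cast hkn)
  have h2 := h2k.trans h.dvd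
  omega
end
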